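/- The map G_{f₀} has sensitive dependence on initial conditions on (X,d): there exists ε > 0 such that for every x ∈ X and every δ > 0 there exist y ∈ X and n ∈ ℕ with d(x,y) < δ and d(G_{f₀}^n(x), G_{f₀}^n(y)) ≥ ε. -/

import Mathlib

open scoped BigOperators

/-- Sum of the discrete Boolean metric over the `N` coordinates (Hamming-type distance). -/
noncomputable def de (N : ℕ) (E F : Fin N → Bool) : ℝ :=
  ∑ k : Fin N, if E k = F k then (0 : ℝ) else 1

/-- Distance between strategies: `(9/N) Σ_k |S^k − Š^k| / 10^k`. -/
noncomputable def ds (N : ℕ) (S T : ℕ → Fin N) : ℝ :=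
  (9 / N) * ∑' k : ℕ, |((S k : ℕ) : ℝ) - ((T k : ℕ) : ℝ)| / 10 ^ (k + 1)

/-- The distance on the phase space `X = {1,…,N}^ℕ × B^N`. -/
noncomputable def dX (N : ℕ) (x y : (ℕ → Fin N) × (Fin N → Bool)) : ℝ :=
  de N x.2 y.2 + ds N x.1 y.1

/-- `F_f(k,E)` agrees with `E` except in coordinate `k`, where it equals `f(E)_k`. -/
def Ff (N : ℕ) (f : (Fin N → Bool) → (Fin N → Bool)) (k : Fin N) (E : Fin N → Bool) :
    Fin N → Bool :=
  fun j => if j = k then f E k else E j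

/-- `G_f(S,E) = (σ(S), F_f(S^1,E))`, where `σ` is the shift on strategies. -/
def G (N : ℕ) (f : (Fin N → Bool) → (Fin N → Bool))
    (x : (ℕ → Fin N) × (Fin N → Bool)) : (ℕ → Fin N) × (Fin N → Bool) :=
  (fun n => x.1 (n + 1), Ff N f (x.1 0) x.2)

/-- The vectorial negation `f₀`. -/
def f0 (N : ℕ) (E : Fin N → Bool) : Fin N → Bool := fun i => !(E i)

/-- A set is open for the metric `dX`. -/
def dOpen (N : ℕ) (U : Set ((ℕ → Fin N) × (Fin N → Bool))) : Prop :=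
  ∀ x ∈ U, ∃ ε > 0, ∀ y, dX N x y < ε → y ∈ U

/-- A set is closed for the metric `dX`. -/
def dClosed (N : ℕ) (A : Set ((ℕ → Fin N) × (Fin N → Bool))) : Prop :=
  dOpen N Aᶜ


/-- Two strategies that differ at most at index `m` have a one-term distance. -/
lemma ds_update (N : ℕ) (S : ℕ → Fin N) (m : ℕ) (b : Fin N) :
    ds N S (Function.update S m b) =
      9 / N * (|((S m : ℕ) : ℝ) - ((b : ℕ) : ℝ)| / 10 ^ (m + 1)) := by
  unfold ds
  rw [tsum_eq_single m]
  · simp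
  · intro k hk
    simp [Function.update_of_ne hk]

lemma de_self (N : ℕ) (E : Fin N → Bool) : de N E E = 0 := by
  simp [de]

lemma de_nonneg (N : ℕ) (E F : Fin N → Bool) : 0 ≤ de N E F :=
  Finset.sum_nonneg fun _ _ => by split_ifs <;> norm_num

/-- Iterating `G` shifts the strategy component. -/
lemma G_iterate_fst (N : ℕ) (f : (Fin N → Bool) → (Fin N → Bool)) (n : ℕ)
    (x : (ℕ → Fin N) × (Fin N → Bool)) :
    ((G N f)^[n] x).1 = fun k => x.1 (k + n) := by
  induction n generalizing x with
  | zero => rfl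
  | succ n ih =>
    rw [Function.iterate_succ_apply, ih]
    funext k
    simp [G, add_assoc]

/-- `G_{f₀}` has sensitive dependence on initial conditions on `(X,d)`. -/
theorem Gf0_sensitive (N : ℕ) (hN : 2 ≤ N) :
    ∃ ε > (0 : ℝ), ∀ x : (ℕ → Fin N) × (Fin N → Bool), ∀ δ > (0 : ℝ),
      ∃ y : (ℕ → Fin N) × (Fin N → Bool), ∃ n : ℕ,
        dX N x y < δ ∧ ε ≤ dX N ((G N (f0 N))^[n] x) ((G N (f0 N))^[n] y) := by
  have hN0 : (0 : ℝ) < N := by exact_mod_cast (by omega : 0 < N)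
  refine ⟨9 / N * (1 / 10), by positivity, ?_⟩
  rintro ⟨S, E⟩ δ hδ
  obtain ⟨m, hm⟩ := exists_pow_lt_of_lt_one (div_pos hδ (by norm_num : (0 : ℝ) < 9))
    (by norm_num : (1 / 10 : ℝ) < 1)
  have : Nontrivial (Fin N) := Fin.nontrivial_iff_two_le.mpr hN
  obtain ⟨b, hb⟩ := exists_ne (S m)
  refine ⟨(Function.update S m b, E), m, ?_, ?_⟩
  · have habs : |((S m : ℕ) : ℝ) - ((b : ℕ) : ℝ)| ≤ N := by
      have h₁ : ((S m : ℕ) : ℝ) ≤ N := by exact_mod_cast (S m).isLt.le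
      have h₂ : ((b : ℕ) : ℝ) ≤ N := by exact_mod_cast b.isLt.le
      rw [abs_le]
      constructor <;> linarith [Nat.cast_nonneg (α := ℝ) (S m : ℕ),
        Nat.cast_nonneg (α := ℝ) (b : ℕ)]
    calc dX N (S, E) (Function.update S m b, E)
        = 9 / N * (|((S m : ℕ) : ℝ) - ((b : ℕ) : ℝ)| / 10 ^ (m + 1)) := by
          simp only [dX, de_self, ds_update, zero_add]
      _ ≤ 9 / N * (N / 10 ^ (m + 1)) := by gcongr
      _ = 9 / 10 * (1 / 10) ^ m := by
          rw [pow_succ, one_div, inv_pow]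
          field_simp
      _ < δ := by
          have : (0 : ℝ) < (1 / 10) ^ m := by positivity
          linarith
  · have hshift : (fun k => Function.update S m b (k + m)) =
        Function.update (fun k => S (k + m)) 0 b := by
      funext k
      by_cases hk : k = 0 <;> simp [hk]
    have habs : (1 : ℝ) ≤ |((S m : ℕ) : ℝ) - ((b : ℕ) : ℝ)| := by
      have hne : ((S m : ℕ) : ℤ) - ((b : ℕ) : ℤ) ≠ 0 := by
        have := Fin.val_ne_of_ne hb
        omega
      exact_mod_cast Int.one_le_abs hne
    unfold dX
    rw [G_iterate_fst, G_iterate_fst, hshift, ds_update]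
    refine le_add_of_nonneg_of_le (de_nonneg _ _ _) ?_
    simp only [zero_add, pow_one]
    gcongr
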